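/- Define λ(ε) = inf{ μ(σ_AB) : σ_AB a two-qubit density matrix with ⟨ψ| σ_AB |ψ⟩ ≥ 1 − 3ε/4 }, where ψ = (|00⟩ + |11⟩)/√2. Then λ(ε) = 0 for ε ≥ 2/3, and for 0 ≤ ε < 2/3 one has 1 − 3ε/2 ≤ λ(ε) ≤ 1 − ε. -/

import Mathlib

open scoped Matrix Kronecker ComplexOrder
open Matrix

noncomputable section

/-- Partial trace over the second (B) system. -/
def ptrB {A B : Type*} [Fintype B] (ρ : Matrix (A × B) (A × B) ℂ) : Matrix A A ℂ :=
  fun i j => ∑ k, ρ (i, k) (j, k)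

/-- Partial trace over the first (A) system. -/
def ptrA {A B : Type*} [Fintype A] (ρ : Matrix (A × B) (A × B) ℂ) : Matrix B B ℂ :=
  fun k l => ∑ i, ρ (i, k) (i, l)

/-- A density matrix: positive semidefinite with trace one. -/
def IsDensity {n : Type*} [Fintype n] (ρ : Matrix n n ℂ) : Prop :=
  ρ.PosSemidef ∧ ρ.trace = 1

/-- Maximal correlation of a bipartite state. -/
def mu {A B : Type*} [Fintype A] [Fintype B] (ρ : Matrix (A × B) (A × B) ℂ) : ℝ :=
  sSup {r : ℝ | ∃ (X : Matrix A A ℂ) (Y : Matrix B B ℂ),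
    ((ptrB ρ) * X).trace = 0 ∧ ((ptrA ρ) * Y).trace = 0 ∧
    ((ptrB ρ) * (X * Xᴴ)).trace = 1 ∧ ((ptrA ρ) * (Y * Yᴴ)).trace = 1 ∧
    r = ‖(ρ * (X ⊗ₖ Yᴴ)).trace‖}

/-- Maximal entanglement: infimum over finite decompositions of the max correlation. -/
def muEnt {A B : Type*} [Fintype A] [Fintype B] (ρ : Matrix (A × B) (A × B) ℂ) : ℝ :=
  sInf {r : ℝ | ∃ (m : ℕ) (p : Fin m → ℝ) (τ : Fin m → Matrix (A × B) (A × B) ℂ),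
    (∀ i, 0 ≤ p i) ∧ (∑ i, p i) = 1 ∧ (∀ i, IsDensity (τ i)) ∧
    ρ = ∑ i, p i • τ i ∧ r = ⨆ i, mu (τ i)}

/-- Application of a product channel given by local Kraus operators. -/
def applyLocal {A B A' B' ι κ : Type*} [Fintype A] [Fintype B] [Fintype ι] [Fintype κ]
    (K : ι → Matrix A' A ℂ) (L : κ → Matrix B' B ℂ)
    (ρ : Matrix (A × B) (A × B) ℂ) : Matrix (A' × B') (A' × B') ℂ :=
  ∑ k, ∑ m, (K k ⊗ₖ L m) * ρ * (K k ⊗ₖ L m)ᴴ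

/-- Tensor product of two bipartite states, with the A-systems grouped together. -/
def prodState {A B A' B' : Type*}
    (ρ : Matrix (A × B) (A × B) ℂ) (σ : Matrix (A' × B') (A' × B') ℂ) :
    Matrix ((A × A') × (B × B')) ((A × A') × (B × B')) ℂ :=
  fun x y => ρ (x.1.1, x.2.1) (y.1.1, y.2.1) * σ (x.1.2, x.2.2) (y.1.2, y.2.2)

/-- n-fold tensor power of a bipartite state, with all A-systems grouped together. -/
def powState {A B : Type*} (ρ : Matrix (A × B) (A × B) ℂ) (n : ℕ) :
    Matrix ((Fin n → A) × (Fin n → B)) ((Fin n → A) × (Fin n → B)) ℂ :=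
  fun x y => ∏ i, ρ (x.1 i, x.2 i) (y.1 i, y.2 i)

/-- The two-qubit Bell vector (|00⟩+|11⟩)/√2. -/
def bellVec : Fin 2 × Fin 2 → ℂ := fun p => if p.1 = p.2 then 1 / (Real.sqrt 2 : ℂ) else 0

/-- The positive semidefinite square root of a positive semidefinite matrix
(the definition of the older Mathlib). -/
def Matrix.PosSemidef.sqrt {n 𝕜 : Type*} [Fintype n] [RCLike 𝕜] [DecidableEq n]
    {A : Matrix n n 𝕜} (hA : A.PosSemidef) : Matrix n n 𝕜 :=
  hA.1.eigenvectorUnitary.1 * diagonal ((↑) ∘ Real.sqrt ∘ hA.1.eigenvalues) *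
  (star hA.1.eigenvectorUnitary : Matrix n n 𝕜)

/-- Inverse of the positive semidefinite square root. -/
def invSqrt {n : Type*} [Fintype n] [DecidableEq n] (M : Matrix n n ℂ) : Matrix n n ℂ :=
  letI := Classical.dec M.PosSemidef
  if h : M.PosSemidef then h.sqrt⁻¹ else 0


/-- The two-qubit isotropic state `(1-ε)|ψ⟩⟨ψ| + ε I/4`. -/
def isoState (ε : ℝ) : Matrix (Fin 2 × Fin 2) (Fin 2 × Fin 2) ℂ :=
  (1 - ε) • Matrix.vecMulVec bellVec (star bellVec) + (ε / 4) • (1 : Matrix (Fin 2 × Fin 2) (Fin 2 × Fin 2) ℂ)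

/-- `λ(ε)`: the smallest maximal correlation among two-qubit states with Bell fidelity
at least `1 - 3ε/4`. -/
def lamEps (ε : ℝ) : ℝ :=
  sInf {r : ℝ | ∃ σ : Matrix (Fin 2 × Fin 2) (Fin 2 × Fin 2) ℂ,
    IsDensity σ ∧ 1 - 3 * ε / 4 ≤ (star bellVec ⬝ᵥ σ.mulVec bellVec).re ∧ r = mu σ}

section Covariance

lemma sub_kronecker_sub {A B : Type*} (X X' : Matrix A A ℂ) (Y Y' : Matrix B B ℂ) :
    (X - X') ⊗ₖ (Y - Y') = X ⊗ₖ Y - X ⊗ₖ Y' - (X' ⊗ₖ Y - X' ⊗ₖ Y') := by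
  ext i j
  simp only [kroneckerMap_apply, Matrix.sub_apply]
  ring

variable {n A B : Type*} [Fintype n] [Fintype A] [Fintype B]

lemma trace_mul_conjTranspose_eq [DecidableEq n] (C P Q : Matrix n n ℂ) :
    ((Cᴴ * C) * (P * Qᴴ)).trace = ∑ i, ∑ j, (C * P) i j * star ((C * Q) i j) := by
  have h : ((Cᴴ * C) * (P * Qᴴ)).trace = ((C * P) * (C * Q)ᴴ).trace := by
    rw [conjTranspose_mul, Matrix.mul_assoc, Matrix.trace_mul_comm]
    simp only [Matrix.mul_assoc]
  rw [h]
  simp only [trace, diag, Matrix.mul_apply (M := C * P), conjTranspose_apply]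

lemma exists_trace_eq_ofReal [DecidableEq n] {ρ : Matrix n n ℂ} (hρ : ρ.PosSemidef)
    (P : Matrix n n ℂ) :
    ∃ v : ℝ, 0 ≤ v ∧ (ρ * (P * Pᴴ)).trace = v := by
  have h : 0 ≤ (ρ * (P * Pᴴ)).trace := by
    rw [← Matrix.mul_assoc, Matrix.trace_mul_comm, ← Matrix.mul_assoc]
    exact (hρ.conjTranspose_mul_mul_same P).trace_nonneg
  obtain ⟨h1, h2⟩ := Complex.le_def.1 h
  exact ⟨_, h1, Complex.ext rfl h2.symm⟩

open scoped MatrixOrder Matrix.Norms.L2Operator in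
lemma exists_eq_conjTranspose_mul_self [DecidableEq n] {ρ : Matrix n n ℂ} (hρ : ρ.PosSemidef) :
    ∃ C : Matrix n n ℂ, ρ = Cᴴ * C :=
  CStarAlgebra.nonneg_iff_eq_star_mul_self.1 hρ.nonneg

/-- Cauchy–Schwarz inequality for the form `(P, Q) ↦ tr (ρ P Qᴴ)`. -/
lemma norm_trace_sq_le [DecidableEq n] {ρ : Matrix n n ℂ} (hρ : ρ.PosSemidef)
    (P Q : Matrix n n ℂ) :
    ‖(ρ * (P * Qᴴ)).trace‖ ^ 2 ≤
      (ρ * (P * Pᴴ)).trace.re * (ρ * (Q * Qᴴ)).trace.re := by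
  obtain ⟨C, rfl⟩ := exists_eq_conjTranspose_mul_self hρ
  have hself : ∀ R : Matrix n n ℂ, ((Cᴴ * C) * (R * Rᴴ)).trace.re =
      ∑ x : n × n, ‖(C * R) x.1 x.2‖ ^ 2 := by
    intro R
    rw [trace_mul_conjTranspose_eq, Fintype.sum_prod_type, Complex.re_sum]
    refine Finset.sum_congr rfl fun i _ => ?_
    rw [Complex.re_sum]
    refine Finset.sum_congr rfl fun j _ => ?_
    rw [Complex.star_def, Complex.mul_conj, Complex.ofReal_re, Complex.normSq_eq_norm_sq]
  rw [hself, hself, trace_mul_conjTranspose_eq, ← Fintype.sum_prod_type']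
  refine le_trans ?_ (Finset.sum_mul_sq_le_sq_mul_sq _ _ _)
  gcongr
  refine (norm_sum_le _ _).trans (Finset.sum_le_sum fun x _ => ?_)
  simp

lemma trace_ptrB_mul [DecidableEq B] (ρ : Matrix (A × B) (A × B) ℂ) (X : Matrix A A ℂ) :
    (ptrB ρ * X).trace = (ρ * (X ⊗ₖ (1 : Matrix B B ℂ))).trace := by
  simp only [trace, diag, Matrix.mul_apply, ptrB, kroneckerMap_apply, Fintype.sum_prod_type,
    Matrix.one_apply, mul_ite, mul_one, mul_zero, Finset.sum_ite_eq', Finset.mem_univ, if_true,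
    Finset.sum_mul]
  refine Finset.sum_congr rfl fun i _ => Finset.sum_comm

lemma trace_ptrA_mul [DecidableEq A] (ρ : Matrix (A × B) (A × B) ℂ) (Y : Matrix B B ℂ) :
    (ptrA ρ * Y).trace = (ρ * ((1 : Matrix A A ℂ) ⊗ₖ Y)).trace := by
  simp only [trace, diag, Matrix.mul_apply, ptrA, kroneckerMap_apply, Fintype.sum_prod_type,
    Matrix.one_apply, ite_mul, one_mul, zero_mul, mul_ite, mul_zero, Finset.sum_mul]
  simp_rw [Finset.sum_comm (s := (Finset.univ : Finset B)) (t := (Finset.univ : Finset A))]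
  refine Finset.sum_congr rfl fun i _ => ?_
  rw [Finset.sum_comm]
  simp only [Finset.sum_ite_eq', Finset.sum_ite_irrel, Finset.sum_const_zero, Finset.mem_univ,
    if_true]
  exact Finset.sum_comm

lemma mu_nonneg (ρ : Matrix (A × B) (A × B) ℂ) : 0 ≤ mu ρ := by
  refine Real.sSup_nonneg ?_
  rintro r ⟨X, Y, -, -, -, -, rfl⟩
  exact norm_nonneg _

lemma trace_ptrB (ρ : Matrix (A × B) (A × B) ℂ) : (ptrB ρ).trace = ρ.trace := by
  simp [trace, ptrB, Fintype.sum_prod_type]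

lemma trace_ptrA (ρ : Matrix (A × B) (A × B) ℂ) : (ptrA ρ).trace = ρ.trace := by
  simp only [trace, diag, ptrA, Fintype.sum_prod_type]
  exact Finset.sum_comm

variable [DecidableEq A] [DecidableEq B]

lemma exists_trace_ptrB_eq_ofReal {ρ : Matrix (A × B) (A × B) ℂ} (hρ : ρ.PosSemidef)
    (X : Matrix A A ℂ) : ∃ v : ℝ, 0 ≤ v ∧ (ptrB ρ * (X * Xᴴ)).trace = v := by
  obtain ⟨v, hv, h⟩ := exists_trace_eq_ofReal hρ (X ⊗ₖ (1 : Matrix B B ℂ))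
  refine ⟨v, hv, ?_⟩
  rw [trace_ptrB_mul, ← h, conjTranspose_kronecker, ← mul_kronecker_mul]
  simp

lemma exists_trace_ptrA_eq_ofReal {ρ : Matrix (A × B) (A × B) ℂ} (hρ : ρ.PosSemidef)
    (Y : Matrix B B ℂ) : ∃ v : ℝ, 0 ≤ v ∧ (ptrA ρ * (Y * Yᴴ)).trace = v := by
  obtain ⟨v, hv, h⟩ := exists_trace_eq_ofReal hρ ((1 : Matrix A A ℂ) ⊗ₖ Y)
  refine ⟨v, hv, ?_⟩
  rw [trace_ptrA_mul, ← h, conjTranspose_kronecker, ← mul_kronecker_mul]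
  simp

lemma norm_trace_kronecker_sq_le {ρ : Matrix (A × B) (A × B) ℂ} (hρ : ρ.PosSemidef)
    (X : Matrix A A ℂ) (Y : Matrix B B ℂ) :
    ‖(ρ * (X ⊗ₖ Yᴴ)).trace‖ ^ 2 ≤
      (ptrB ρ * (X * Xᴴ)).trace.re * (ptrA ρ * (Y * Yᴴ)).trace.re := by
  have h := norm_trace_sq_le hρ (X ⊗ₖ (1 : Matrix B B ℂ)) ((1 : Matrix A A ℂ) ⊗ₖ Y)
  simpa only [conjTranspose_kronecker, ← mul_kronecker_mul, conjTranspose_one, Matrix.mul_one,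
    Matrix.one_mul, ← trace_ptrA_mul, ← trace_ptrB_mul] using h

lemma norm_trace_kronecker_le_one {ρ : Matrix (A × B) (A × B) ℂ} (hρ : ρ.PosSemidef)
    {X : Matrix A A ℂ} {Y : Matrix B B ℂ} (hX : (ptrB ρ * (X * Xᴴ)).trace = 1)
    (hY : (ptrA ρ * (Y * Yᴴ)).trace = 1) : ‖(ρ * (X ⊗ₖ Yᴴ)).trace‖ ≤ 1 := by
  have h := norm_trace_kronecker_sq_le hρ X Y
  rw [hX, hY, Complex.one_re, one_mul] at h
  exact (sq_le_one_iff₀ (norm_nonneg _)).1 h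

lemma mu_le_one {ρ : Matrix (A × B) (A × B) ℂ} (hρ : ρ.PosSemidef) : mu ρ ≤ 1 := by
  refine Real.sSup_le ?_ zero_le_one
  rintro r ⟨X, Y, -, -, hX, hY, rfl⟩
  exact norm_trace_kronecker_le_one hρ hX hY

lemma norm_trace_kronecker_le_mu {ρ : Matrix (A × B) (A × B) ℂ} (hρ : ρ.PosSemidef)
    {X : Matrix A A ℂ} {Y : Matrix B B ℂ} (hX0 : (ptrB ρ * X).trace = 0)
    (hY0 : (ptrA ρ * Y).trace = 0) (hX : (ptrB ρ * (X * Xᴴ)).trace = 1)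
    (hY : (ptrA ρ * (Y * Yᴴ)).trace = 1) : ‖(ρ * (X ⊗ₖ Yᴴ)).trace‖ ≤ mu ρ := by
  refine le_csSup ⟨1, ?_⟩ ⟨X, Y, hX0, hY0, hX, hY, rfl⟩
  rintro r ⟨X, Y, -, -, hX, hY, rfl⟩
  exact norm_trace_kronecker_le_one hρ hX hY

lemma norm_trace_kronecker_le_mu_mul {ρ : Matrix (A × B) (A × B) ℂ} (hρ : ρ.PosSemidef)
    {X : Matrix A A ℂ} {Y : Matrix B B ℂ} (hX0 : (ptrB ρ * X).trace = 0)
    (hY0 : (ptrA ρ * Y).trace = 0) :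
    ‖(ρ * (X ⊗ₖ Yᴴ)).trace‖ ≤
      mu ρ * (((ptrB ρ * (X * Xᴴ)).trace.re + (ptrA ρ * (Y * Yᴴ)).trace.re) / 2) := by
  obtain ⟨v, hv, hX⟩ := exists_trace_ptrB_eq_ofReal hρ X
  obtain ⟨w, hw, hY⟩ := exists_trace_ptrA_eq_ofReal hρ Y
  have hμ := mu_nonneg ρ
  have hcs := norm_trace_kronecker_sq_le hρ X Y
  rw [hX, hY, Complex.ofReal_re, Complex.ofReal_re] at hcs ⊢
  by_cases hvw : v * w = 0
  · have h0 : ‖(ρ * (X ⊗ₖ Yᴴ)).trace‖ = 0 := by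
      rw [hvw] at hcs
      exact pow_eq_zero_iff two_ne_zero |>.1 (le_antisymm hcs (sq_nonneg _))
    rw [h0]
    positivity
  · have hv0 : 0 < v := lt_of_le_of_ne hv fun h => hvw (by rw [← h, zero_mul])
    have hw0 : 0 < w := lt_of_le_of_ne hw fun h => hvw (by rw [← h, mul_zero])
    obtain ⟨s, hs, rfl⟩ : ∃ s : ℝ, 0 < s ∧ s ^ 2 = v :=
      ⟨√v, Real.sqrt_pos.2 hv0, Real.sq_sqrt hv⟩
    obtain ⟨t, ht, rfl⟩ : ∃ t : ℝ, 0 < t ∧ t ^ 2 = w :=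
      ⟨√w, Real.sqrt_pos.2 hw0, Real.sq_sqrt hw⟩
    have hs' : (s : ℂ) ≠ 0 := by exact_mod_cast hs.ne'
    have ht' : (t : ℂ) ≠ 0 := by exact_mod_cast ht.ne'
    have key := norm_trace_kronecker_le_mu hρ (X := ((s : ℂ)⁻¹) • X) (Y := ((t : ℂ)⁻¹) • Y)
      (by simp [hX0]) (by simp [hY0])
      (by simp [hX, conjTranspose_smul]; field_simp)
      (by simp [hY, conjTranspose_smul]; field_simp)
    simp only [conjTranspose_smul, smul_kronecker, kronecker_smul, Matrix.mul_smul, trace_smul,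
      norm_smul, norm_star, norm_inv, Complex.norm_real, Real.norm_eq_abs, abs_of_pos hs,
      abs_of_pos ht] at key
    have h2 : ‖(ρ * (X ⊗ₖ Yᴴ)).trace‖ ≤ mu ρ * (s * t) := by
      rw [← mul_assoc, ← mul_inv, inv_mul_le_iff₀ (by positivity)] at key
      linarith
    refine h2.trans (mul_le_mul_of_nonneg_left ?_ hμ)
    nlinarith [sq_nonneg (s - t)]

lemma re_trace_mul_centered {n : Type*} [Fintype n] [DecidableEq n] {ρ : Matrix n n ℂ}
    (h1 : ρ.trace = 1) (X : Matrix n n ℂ) (hX : (ρ * Xᴴ).trace = star (ρ * X).trace) :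
    (ρ * ((X - (ρ * X).trace • 1) * (X - (ρ * X).trace • 1)ᴴ)).trace.re =
      (ρ * (X * Xᴴ)).trace.re - ‖(ρ * X).trace‖ ^ 2 := by
  have h : (ρ * ((X - (ρ * X).trace • 1) * (X - (ρ * X).trace • 1)ᴴ)).trace =
      (ρ * (X * Xᴴ)).trace - (ρ * X).trace * star (ρ * X).trace := by
    simp only [conjTranspose_sub, conjTranspose_smul, conjTranspose_one, Matrix.mul_sub,
      Matrix.sub_mul, trace_sub, Matrix.smul_mul, Matrix.mul_smul, Matrix.one_mul, Matrix.mul_one,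
      trace_smul, h1, hX, smul_eq_mul]
    ring
  rw [h, Complex.sub_re, Complex.star_def, Complex.mul_conj, Complex.ofReal_re,
    Complex.normSq_eq_norm_sq]

/-- The maximal correlation bounds the covariance of arbitrary local observables. -/
lemma norm_covariance_le {ρ : Matrix (A × B) (A × B) ℂ} (hρ : IsDensity ρ)
    (X : Matrix A A ℂ) (Y : Matrix B B ℂ) :
    ‖(ρ * (X ⊗ₖ Yᴴ)).trace - (ptrB ρ * X).trace * star (ptrA ρ * Y).trace‖ ≤
      mu ρ * (((ptrB ρ * (X * Xᴴ)).trace.re - ‖(ptrB ρ * X).trace‖ ^ 2 +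
        ((ptrA ρ * (Y * Yᴴ)).trace.re - ‖(ptrA ρ * Y).trace‖ ^ 2)) / 2) := by
  have hstar : ∀ Z : Matrix (A × B) (A × B) ℂ, (ρ * Zᴴ).trace = star (ρ * Z).trace := by
    intro Z
    rw [← trace_conjTranspose, conjTranspose_mul, hρ.1.1.eq, Matrix.trace_mul_comm]
  have hB : (ptrB ρ * Xᴴ).trace = star (ptrB ρ * X).trace := by
    rw [trace_ptrB_mul, trace_ptrB_mul, ← hstar, conjTranspose_kronecker, conjTranspose_one]
  have hA : (ptrA ρ * Yᴴ).trace = star (ptrA ρ * Y).trace := by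
    rw [trace_ptrA_mul, trace_ptrA_mul, ← hstar, conjTranspose_kronecker, conjTranspose_one]
  have h1B := (trace_ptrB ρ).trans hρ.2
  have h1A := (trace_ptrA ρ).trans hρ.2
  rw [← re_trace_mul_centered h1B X hB, ← re_trace_mul_centered h1A Y hA]
  refine le_of_eq_of_le (congrArg norm ?_) (norm_trace_kronecker_le_mu_mul hρ.1 ?_ ?_)
  · simp only [conjTranspose_sub, conjTranspose_smul, conjTranspose_one, sub_kronecker_sub,
      smul_kronecker, kronecker_smul, Matrix.mul_sub, Matrix.mul_smul, trace_sub,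
      trace_smul, ← trace_ptrB_mul, ← trace_ptrA_mul, hA, one_kronecker_one, Matrix.mul_one, hρ.2,
      smul_eq_mul]
    ring
  · simp [Matrix.mul_sub, h1B]
  · simp [Matrix.mul_sub, h1A]

lemma norm_ptrB_sq_le {ρ : Matrix (A × B) (A × B) ℂ} (hρ : ρ.PosSemidef) (i j : A) :
    ‖ptrB ρ i j‖ ^ 2 ≤ (ptrB ρ i i).re * (ptrB ρ j j).re := by
  have h := norm_trace_sq_le hρ (Matrix.single j i 1 ⊗ₖ (1 : Matrix B B ℂ))
    (Matrix.single i i 1 ⊗ₖ (1 : Matrix B B ℂ))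
  simp only [conjTranspose_kronecker, ← mul_kronecker_mul, conjTranspose_one, Matrix.mul_one,
    ← trace_ptrB_mul, conjTranspose_single, star_one, single_mul_single_same, trace_mul_single] at h
  simpa [mul_comm] using h

lemma norm_ptrA_sq_le {ρ : Matrix (A × B) (A × B) ℂ} (hρ : ρ.PosSemidef) (i j : B) :
    ‖ptrA ρ i j‖ ^ 2 ≤ (ptrA ρ i i).re * (ptrA ρ j j).re := by
  have h := norm_trace_sq_le hρ ((1 : Matrix A A ℂ) ⊗ₖ Matrix.single j i 1)
    ((1 : Matrix A A ℂ) ⊗ₖ Matrix.single i i 1)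
  simp only [conjTranspose_kronecker, ← mul_kronecker_mul, conjTranspose_one, Matrix.mul_one,
    ← trace_ptrA_mul, conjTranspose_single, star_one, single_mul_single_same, trace_mul_single] at h
  simpa [mul_comm] using h

lemma sum_norm_ptrB_sq_le_one {ρ : Matrix (A × B) (A × B) ℂ} (hρ : IsDensity ρ) :
    ∑ i, ∑ j, ‖ptrB ρ i j‖ ^ 2 ≤ 1 := by
  have h1 : ∑ i, (ptrB ρ i i).re = 1 := by
    rw [← Complex.re_sum]
    exact congrArg Complex.re ((trace_ptrB ρ).trans hρ.2)
  calc ∑ i, ∑ j, ‖ptrB ρ i j‖ ^ 2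
      ≤ ∑ i, ∑ j, (ptrB ρ i i).re * (ptrB ρ j j).re :=
        Finset.sum_le_sum fun i _ => Finset.sum_le_sum fun j _ => norm_ptrB_sq_le hρ.1 i j
    _ = 1 := by simp_rw [← Finset.mul_sum, h1, mul_one, h1]

lemma sum_norm_ptrA_sq_le_one {ρ : Matrix (A × B) (A × B) ℂ} (hρ : IsDensity ρ) :
    ∑ i, ∑ j, ‖ptrA ρ i j‖ ^ 2 ≤ 1 := by
  have h1 : ∑ i, (ptrA ρ i i).re = 1 := by
    rw [← Complex.re_sum]
    exact congrArg Complex.re ((trace_ptrA ρ).trans hρ.2)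
  calc ∑ i, ∑ j, ‖ptrA ρ i j‖ ^ 2
      ≤ ∑ i, ∑ j, (ptrA ρ i i).re * (ptrA ρ j j).re :=
        Finset.sum_le_sum fun i _ => Finset.sum_le_sum fun j _ => norm_ptrA_sq_le hρ.1 i j
    _ = 1 := by simp_rw [← Finset.mul_sum, h1, mul_one, h1]

lemma trace_mul_single_kronecker_single (ρ : Matrix (A × B) (A × B) ℂ) (k l : A) (k' l' : B) :
    (ρ * (Matrix.single k l 1 ⊗ₖ Matrix.single k' l' 1)).trace = ρ (l, l') (k, k') := by
  simp [single_kronecker_single, trace_mul_single]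

lemma covariance_single_le {ρ : Matrix (A × B) (A × B) ℂ} (hρ : IsDensity ρ) (k l : A)
    (k' l' : B) :
    (ρ (l, l') (k, k')).re ≤ (‖ptrB ρ l k‖ ^ 2 + ‖ptrA ρ k' l'‖ ^ 2) / 2 +
      mu ρ * (((ptrB ρ k k).re - ‖ptrB ρ l k‖ ^ 2 +
        ((ptrA ρ l' l').re - ‖ptrA ρ k' l'‖ ^ 2)) / 2) := by
  have h := norm_covariance_le hρ (Matrix.single k l 1) (Matrix.single l' k' 1)
  simp only [conjTranspose_single, star_one, trace_mul_single_kronecker_single, trace_mul_single,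
    single_mul_single_same, mul_one, MulOpposite.op_one, one_smul] at h
  have h2 : (ptrB ρ l k * star (ptrA ρ k' l')).re ≤
      (‖ptrB ρ l k‖ ^ 2 + ‖ptrA ρ k' l'‖ ^ 2) / 2 := by
    refine (Complex.re_le_norm _).trans ?_
    rw [norm_mul, norm_star]
    nlinarith [sq_nonneg (‖ptrB ρ l k‖ - ‖ptrA ρ k' l'‖)]
  have h3 := (Complex.re_le_norm _).trans h
  rw [Complex.sub_re] at h3
  linarith

end Covariance

lemma bell_fidelity_eq (σ : Matrix (Fin 2 × Fin 2) (Fin 2 × Fin 2) ℂ) :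
    (star bellVec ⬝ᵥ σ.mulVec bellVec) = (∑ l, ∑ k, σ (l, l) (k, k)) / 2 := by
  have h2 : ((√2 : ℝ) : ℂ) ^ 2 = 2 := by
    rw [← Complex.ofReal_pow, Real.sq_sqrt zero_le_two, Complex.ofReal_ofNat]
  have h0 : ((√2 : ℝ) : ℂ) ≠ 0 := by
    intro h
    simp [h] at h2
  simp [dotProduct, mulVec, bellVec, Fintype.sum_prod_type, Fin.sum_univ_two]
  field_simp
  rw [h2]
  ring

/-- The Bell fidelity `F` of a two-qubit state satisfies `2F - 1 ≤ μ`. -/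
lemma two_mul_fidelity_sub_one_le_mu {σ : Matrix (Fin 2 × Fin 2) (Fin 2 × Fin 2) ℂ}
    (hσ : IsDensity σ) :
    2 * (star bellVec ⬝ᵥ σ.mulVec bellVec).re - 1 ≤ mu σ := by
  have hA := congrArg Complex.re ((trace_ptrB σ).trans hσ.2)
  have hB := congrArg Complex.re ((trace_ptrA σ).trans hσ.2)
  have ha := sum_norm_ptrB_sq_le_one hσ
  have hb := sum_norm_ptrA_sq_le_one hσ
  have h00 := covariance_single_le hσ 0 0 0 0
  have h01 := covariance_single_le hσ 0 1 0 1
  have h10 := covariance_single_le hσ 1 0 1 0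
  have h11 := covariance_single_le hσ 1 1 1 1
  have h1 := mu_le_one hσ.1
  rw [bell_fidelity_eq]
  simp only [Fin.sum_univ_two, trace, diag, Complex.add_re, Complex.one_re, Complex.div_ofNat_re]
    at *
  set s := (‖ptrB σ 0 0‖ ^ 2 + ‖ptrB σ 0 1‖ ^ 2 + (‖ptrB σ 1 0‖ ^ 2 + ‖ptrB σ 1 1‖ ^ 2) +
    (‖ptrA σ 0 0‖ ^ 2 + ‖ptrA σ 0 1‖ ^ 2 + (‖ptrA σ 1 0‖ ^ 2 + ‖ptrA σ 1 1‖ ^ 2))) / 2 with hs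
  have hsum : (σ (0, 0) (0, 0)).re + (σ (0, 0) (1, 1)).re +
      ((σ (1, 1) (0, 0)).re + (σ (1, 1) (1, 1)).re) ≤ s + mu σ * (2 - s) := by
    have e : mu σ * (2 - s) = mu σ * ((ptrB σ 0 0).re + (ptrB σ 1 1).re +
      ((ptrA σ 0 0).re + (ptrA σ 1 1).re) - s) := by rw [hA, hB]; ring
    rw [e, hs]
    linarith
  have hs1 : s ≤ 1 := by linarith
  nlinarith [mul_nonneg (sub_nonneg.2 h1) (sub_nonneg.2 hs1)]

lemma trace_vecMulVec_bellVec_mul (M : Matrix (Fin 2 × Fin 2) (Fin 2 × Fin 2) ℂ) :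
    (vecMulVec bellVec (star bellVec) * M).trace = (∑ l, ∑ k, M (l, l) (k, k)) / 2 := by
  rw [← bell_fidelity_eq, vecMulVec_mul, trace_vecMulVec, dotProduct_comm, dotProduct_mulVec]

lemma dotProduct_bellVec : star bellVec ⬝ᵥ bellVec = 1 := by
  have h := bell_fidelity_eq 1
  rw [one_mulVec] at h
  rw [h]
  simp [Matrix.one_apply]

lemma isDensity_isoState {ε : ℝ} (h0 : 0 ≤ ε) (h1 : ε ≤ 1) : IsDensity (isoState ε) := by
  refine ⟨?_, ?_⟩
  · refine PosSemidef.add ?_ ?_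
    · exact (posSemidef_vecMulVec_self_star _).smul (sub_nonneg.2 h1)
    · exact PosSemidef.one.smul (by positivity)
  · simp [isoState, trace_vecMulVec, dotProduct_comm bellVec, dotProduct_bellVec]

lemma fidelity_isoState (ε : ℝ) :
    (star bellVec ⬝ᵥ (isoState ε).mulVec bellVec).re = 1 - 3 * ε / 4 := by
  have h : star bellVec ⬝ᵥ (isoState ε).mulVec bellVec = ((1 - 3 * ε / 4 : ℝ) : ℂ) := by
    simp [isoState, add_mulVec, smul_mulVec, vecMulVec_mulVec, dotProduct_bellVec]
    ring
  rw [h, Complex.ofReal_re]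

lemma trace_isoState_mul (ε : ℝ) (X Z : Matrix (Fin 2) (Fin 2) ℂ) :
    (isoState ε * (X ⊗ₖ Z)).trace =
      (1 - ε) * ((∑ l, ∑ k, X l k * Z l k) / 2) + ε / 4 * (X.trace * Z.trace) := by
  rw [isoState, Matrix.add_mul, trace_add, Matrix.smul_mul, Matrix.smul_mul, trace_smul,
    trace_smul, trace_vecMulVec_bellVec_mul, Matrix.one_mul, trace_kronecker]
  simp

lemma trace_ptrB_isoState_mul (ε : ℝ) (X : Matrix (Fin 2) (Fin 2) ℂ) :
    (ptrB (isoState ε) * X).trace = X.trace / 2 := by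
  rw [trace_ptrB_mul, trace_isoState_mul]
  simp [Matrix.one_apply, trace]
  ring

lemma trace_ptrA_isoState_mul (ε : ℝ) (Y : Matrix (Fin 2) (Fin 2) ℂ) :
    (ptrA (isoState ε) * Y).trace = Y.trace / 2 := by
  rw [trace_ptrA_mul, trace_isoState_mul]
  simp [Matrix.one_apply, trace]
  ring

lemma sum_norm_sq_eq_re_trace {n : Type*} [Fintype n] (X : Matrix n n ℂ) :
    ∑ l, ∑ k, ‖X l k‖ ^ 2 = (X * Xᴴ).trace.re := by
  simp [trace, Matrix.mul_apply, Complex.mul_conj, Complex.normSq_eq_norm_sq, -Complex.ofReal_pow]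

lemma mu_isoState_le {ε : ℝ} (h1 : ε ≤ 1) : mu (isoState ε) ≤ 1 - ε := by
  refine Real.sSup_le ?_ (sub_nonneg.2 h1)
  rintro r ⟨X, Y, hX0, hY0, hX, hY, rfl⟩
  rw [trace_ptrB_isoState_mul] at hX0 hX
  rw [trace_ptrA_isoState_mul] at hY0 hY
  have hX0' : X.trace = 0 := by simpa using hX0
  have hX2 : ∑ l, ∑ k, ‖X l k‖ ^ 2 = 2 := by
    rw [sum_norm_sq_eq_re_trace, (div_eq_one_iff_eq two_ne_zero).1 hX, Complex.re_ofNat]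
  have hY2 : ∑ l, ∑ k, ‖Yᴴ l k‖ ^ 2 = 2 := by
    rw [sum_norm_sq_eq_re_trace, conjTranspose_conjTranspose, Matrix.trace_mul_comm,
      (div_eq_one_iff_eq two_ne_zero).1 hY, Complex.re_ofNat]
  have hle : ‖∑ l, ∑ k, X l k * Yᴴ l k‖ ≤ 2 := by
    calc ‖∑ l, ∑ k, X l k * Yᴴ l k‖
        ≤ ∑ l, ∑ k, (‖X l k‖ ^ 2 + ‖Yᴴ l k‖ ^ 2) / 2 := by
          refine (norm_sum_le _ _).trans (Finset.sum_le_sum fun l _ => ?_)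
          refine (norm_sum_le _ _).trans (Finset.sum_le_sum fun k _ => ?_)
          rw [norm_mul]
          nlinarith [sq_nonneg (‖X l k‖ - ‖Yᴴ l k‖)]
      _ = 2 := by
          simp_rw [← Finset.sum_div, Finset.sum_add_distrib]
          rw [hX2, hY2]
          norm_num
  have hn : ‖(1 - ε : ℂ)‖ = 1 - ε := by
    rw [← Complex.ofReal_one, ← Complex.ofReal_sub, Complex.norm_real,
      Real.norm_of_nonneg (sub_nonneg.2 h1)]
  rw [trace_isoState_mul, hX0', zero_mul, mul_zero, add_zero, norm_mul, hn, norm_div,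
    Complex.norm_ofNat]
  exact mul_le_of_le_one_right (sub_nonneg.2 h1) (by linarith)

/-- The product state `|00⟩⟨00|`. -/
def zeroState : Matrix (Fin 2 × Fin 2) (Fin 2 × Fin 2) ℂ := Matrix.single (0, 0) (0, 0) 1

lemma isDensity_zeroState : IsDensity zeroState := by
  refine ⟨?_, by simp [zeroState]⟩
  have h := posSemidef_conjTranspose_mul_self zeroState
  simpa [zeroState] using h

lemma fidelity_zeroState : (star bellVec ⬝ᵥ zeroState.mulVec bellVec).re = 1 / 2 := by
  simp only [bell_fidelity_eq, zeroState, Fin.sum_univ_two]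
  simp

lemma mu_zeroState : mu zeroState = 0 := by
  refine le_antisymm (Real.sSup_le ?_ le_rfl) (mu_nonneg _)
  rintro r ⟨X, Y, hX0, -, -, -, rfl⟩
  have hX : X 0 0 = 0 := by
    rw [trace_ptrB_mul] at hX0
    simpa [zeroState, trace_single_mul] using hX0
  simp [zeroState, trace_single_mul, hX]

/-- Bounds on `λ(ε)`: it vanishes for `ε ≥ 2/3` and satisfies
`1 - 3ε/2 ≤ λ(ε) ≤ 1 - ε` for `0 ≤ ε < 2/3`. -/
theorem lamEps_bounds (ε : ℝ) :
    (2 / 3 ≤ ε → lamEps ε = 0) ∧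
    (0 ≤ ε → ε < 2 / 3 → 1 - 3 * ε / 2 ≤ lamEps ε ∧ lamEps ε ≤ 1 - ε) := by
  have hbdd : BddBelow {r : ℝ | ∃ σ : Matrix (Fin 2 × Fin 2) (Fin 2 × Fin 2) ℂ,
      IsDensity σ ∧ 1 - 3 * ε / 4 ≤ (star bellVec ⬝ᵥ σ.mulVec bellVec).re ∧ r = mu σ} := by
    refine ⟨0, ?_⟩
    rintro r ⟨σ, -, -, rfl⟩
    exact mu_nonneg σ
  refine ⟨fun h => le_antisymm ?_ ?_, fun h0 h1 => ⟨?_, ?_⟩⟩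
  · refine csInf_le hbdd ⟨zeroState, isDensity_zeroState, ?_, mu_zeroState.symm⟩
    rw [fidelity_zeroState]
    linarith
  · refine Real.sInf_nonneg ?_
    rintro r ⟨σ, -, -, rfl⟩
    exact mu_nonneg σ
  · refine le_csInf ⟨_, isoState ε, isDensity_isoState h0 (by linarith),
      (fidelity_isoState ε).ge, rfl⟩ ?_
    rintro r ⟨σ, hσ, hF, rfl⟩
    linarith [two_mul_fidelity_sub_one_le_mu hσ]
  · exact (csInf_le hbdd ⟨isoState ε, isDensity_isoState h0 (by linarith),
      (fidelity_isoState ε).ge, rfl⟩).trans (mu_isoState_le (by linarith))
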